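/- Under the contiguous alternatives σ_ε = σ + √ε(d + F(√ε)), for 0≤t≤1 one has Ÿ_ε(t) = σ_ε b̈_H^ε(t) + a_ε(t), where for every δ>0, almost surely there exist C(ω)>0 and ε_0(ω)>0 such that for all 0<ε≤ε_0 and all t∈[0,1]: |a_ε(t)| ≤ C(ω)(ε^{H−2−δ} 1_{{0≤t≤ε}} + ε^{2H−2−δ} 1_{{ε≤t≤1}}). -/

import Mathlib

open MeasureTheory ProbabilityTheory Filter Topology
open scoped FourierTransform

noncomputable section

namespace FBMPaper

variable {Ω : Type} [MeasurableSpace Ω]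

/-- The constant `v_{2H}²  = (Γ(2H+1) sin(πH))⁻¹`. -/
def v2Hsq (H : ℝ) : ℝ := (Real.Gamma (2 * H + 1) * Real.sin (Real.pi * H))⁻¹

/-- Covariance function of fractional Brownian motion with Hurst parameter `H`. -/
def fbmCov (H s t : ℝ) : ℝ :=
  (1 / 2) * v2Hsq H * (|t| ^ (2 * H) + |s| ^ (2 * H) - |t - s| ^ (2 * H))

/-- `bH` is a fractional Brownian motion with Hurst parameter `H` under `P`:
a centered Gaussian process with the fBm covariance, with almost surely continuous
sample paths which are locally `(H - δ)`-Hölder continuous for every `δ > 0`. -/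
structure IsFBM (P : Measure Ω) (H : ℝ) (bH : ℝ → Ω → ℝ) : Prop where
  measurable : ∀ t, Measurable (bH t)
  gaussian : ∀ (n : ℕ) (t a : Fin n → ℝ), ∃ v : NNReal,
    P.map (fun ω => ∑ i, a i * bH (t i) ω) = gaussianReal 0 v
  covariance : ∀ s t, ∫ ω, bH s ω * bH t ω ∂P = fbmCov H s t
  cont : ∀ᵐ ω ∂P, Continuous fun t => bH t ω
  holder : ∀ δ, 0 < δ → δ < H → ∀ᵐ ω ∂P, ∀ R, 0 < R → ∃ C, 0 < C ∧
    ∀ s ∈ Set.Icc (-R) R, ∀ t ∈ Set.Icc (-R) R,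
      |bH t ω - bH s ω| ≤ C * |t - s| ^ (H - δ)

/-- `φ` is a `C²` probability density with compact support contained in `[-1,1]`. -/
structure IsKernel (φ : ℝ → ℝ) : Prop where
  smooth : ContDiff ℝ 2 φ
  nonneg : ∀ x, 0 ≤ φ x
  integral_one : ∫ x, φ x = 1
  support : Function.support φ ⊆ Set.Icc (-1) 1

/-- Smoothing by convolution: `(φ_ε * f)(t) = ε⁻¹ ∫ φ((t-x)/ε) f(x) dx`. -/
def mollify (φ : ℝ → ℝ) (ε : ℝ) (f : ℝ → ℝ) (t : ℝ) : ℝ :=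
  ε⁻¹ * ∫ x, φ ((t - x) / ε) * f x

/-- second derivative -/
def dd (f : ℝ → ℝ) : ℝ → ℝ := deriv (deriv f)

/-- `φ` seen as a complex valued function. -/
def phiC (φ : ℝ → ℝ) : ℝ → ℂ := fun x => (φ x : ℂ)

/-- `σ_{2H}² = (2π)⁻¹ ∫ |x|^{3-2H} |φ̂(-x)|² dx`. -/
def sigma2Hsq (φ : ℝ → ℝ) (H : ℝ) : ℝ :=
  (2 * Real.pi)⁻¹ * ∫ x : ℝ, |x| ^ (3 - 2 * H) * ‖𝓕 (phiC φ) (-x)‖ ^ 2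

def sigma2H (φ : ℝ → ℝ) (H : ℝ) : ℝ := Real.sqrt (sigma2Hsq φ H)

/-- `σ̃_{2H}² = (2π)⁻¹ ∫ |x|^{1-2H} |φ̂(-x)|² dx`. -/
def sigma2HtildeSq (φ : ℝ → ℝ) (H : ℝ) : ℝ :=
  (2 * Real.pi)⁻¹ * ∫ x : ℝ, |x| ^ (1 - 2 * H) * ‖𝓕 (phiC φ) (-x)‖ ^ 2

def sigma2Htilde (φ : ℝ → ℝ) (H : ℝ) : ℝ := Real.sqrt (sigma2HtildeSq φ H)

/-- `Z_ε(t) = ε^{2-H} b̈_H^ε(t) / σ_{2H}` (for a general underlying process). -/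
def Zeps (φ : ℝ → ℝ) (H : ℝ) (b : ℝ → Ω → ℝ) (ε : ℝ) (ω : Ω) (t : ℝ) : ℝ :=
  ε ^ (2 - H) * dd (mollify φ ε fun s => b s ω) t / sigma2H φ H

/-- Absolute moment `E|N|^k` of a standard Gaussian random variable. -/
def gaussAbsMoment (k : ℝ) : ℝ := ∫ x, |x| ^ k ∂(gaussianReal 0 1)

/-- `n`-th Hermite coefficient `ĝ_n = (n!)⁻¹ ∫ g(x) H_n(x) ϕ(x) dx`. -/
def hermiteCoeff (g : ℝ → ℝ) (n : ℕ) : ℝ :=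
  ((Nat.factorial n : ℝ))⁻¹ * ∫ x, g x * (Polynomial.aeval x (Polynomial.hermite n)) ∂(gaussianReal 0 1)

/-- `S_g(ε) = ε^{-1/2} ∫_0^1 g(Z_ε(u)) du`. -/
def Sg (φ : ℝ → ℝ) (H : ℝ) (b : ℝ → Ω → ℝ) (g : ℝ → ℝ) (ε : ℝ) (ω : Ω) : ℝ :=
  ε ^ (-(1 / 2 : ℝ)) * ∫ u in (0:ℝ)..1, g (Zeps φ H b ε ω u)

/-- `ρ_H(x,b,c)`: the correlation kernel at two scales. -/
def rhoH2 (φ : ℝ → ℝ) (H b c x : ℝ) : ℝ :=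
  ((b * c) ^ (2 - H) / (2 * Real.pi * sigma2Hsq φ H)) *
    (∫ y : ℝ, ((|y| ^ (3 - 2 * H) : ℝ) : ℂ) *
      (Complex.exp (Complex.I * ((x * y : ℝ) : ℂ)) *
        𝓕 (phiC φ) (-(b * y)) * 𝓕 (phiC φ) (c * y))).re

/-- `ρ_g(b,c) = (bc)^{-1/2} Σ_{n≥1} ĝ_n² n! ∫ ρ_H(x,b,c)^n dx`. -/
def rhoG (φ : ℝ → ℝ) (H : ℝ) (g : ℝ → ℝ) (b c : ℝ) : ℝ :=
  (b * c) ^ (-(1 / 2 : ℝ)) * ∑' n : ℕ,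
    (hermiteCoeff g (n + 1)) ^ 2 * (Nat.factorial (n + 1) : ℝ) * ∫ x : ℝ, (rhoH2 φ H b c x) ^ (n + 1)

/-- `ρ_H(x)`, the one-scale correlation function (second-derivative case). -/
def rhoH1 (φ : ℝ → ℝ) (H x : ℝ) : ℝ :=
  (2 * Real.pi * sigma2Hsq φ H)⁻¹ *
    (∫ y : ℝ, ((|y| ^ (3 - 2 * H) : ℝ) : ℂ) *
      (Complex.exp (Complex.I * ((x * y : ℝ) : ℂ)) * ((‖𝓕 (phiC φ) (-y)‖ ^ 2 : ℝ) : ℂ))).re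

/-- `ρ̄_H(x)`, the one-scale correlation function (first-derivative case). -/
def rhoH1tilde (φ : ℝ → ℝ) (H x : ℝ) : ℝ :=
  (2 * Real.pi * sigma2HtildeSq φ H)⁻¹ *
    (∫ y : ℝ, ((|y| ^ (1 - 2 * H) : ℝ) : ℂ) *
      (Complex.exp (Complex.I * ((x * y : ℝ) : ℂ)) * ((‖𝓕 (phiC φ) (-y)‖ ^ 2 : ℝ) : ℂ))).re

/-- `σ_g² = Σ_{n≥1} ĝ_n² n! ∫ ρ(x)^n dx` for a correlation function `ρ`. -/
def sigmaGsq (g : ℝ → ℝ) (ρ : ℝ → ℝ) : ℝ :=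
  ∑' n : ℕ, (hermiteCoeff g (n + 1)) ^ 2 * (Nat.factorial (n + 1) : ℝ) * ∫ x : ℝ, (ρ x) ^ (n + 1)

/-- the function `g_k(x) = |x|^k / E|N|^k - 1`. -/
def gk (k : ℝ) (x : ℝ) : ℝ := |x| ^ k / gaussAbsMoment k - 1

/-- the function `g_1(x) = √(π/2)|x| - 1`. -/
def g1 (x : ℝ) : ℝ := Real.sqrt (Real.pi / 2) * |x| - 1


lemma support_deriv_subset_Icc {ψ : ℝ → ℝ} {a b : ℝ} (h : Function.support ψ ⊆ Set.Icc a b) :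
    Function.support (deriv ψ) ⊆ Set.Icc a b :=
  support_deriv_subset.trans (closure_minimal h isClosed_Icc)

lemma rescaled_eq_zero {ψ : ℝ → ℝ} (h : Function.support ψ ⊆ Set.Icc (-1) 1) {ε : ℝ} (hε : 0 < ε)
    {t x : ℝ} (hx : x ∉ Set.Icc (t - ε) (t + ε)) : ψ ((t - x) / ε) = 0 := by
  by_contra hne
  obtain ⟨h₁, h₂⟩ := h hne
  rw [le_div_iff₀ hε] at h₁
  rw [div_le_iff₀ hε] at h₂
  exact hx ⟨by linarith, by linarith⟩

lemma hasCompactSupport_rescaled {ψ : ℝ → ℝ} (h : Function.support ψ ⊆ Set.Icc (-1) 1) {ε : ℝ}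
    (hε : 0 < ε) (t : ℝ) : HasCompactSupport fun x => ψ ((t - x) / ε) :=
  HasCompactSupport.intro (isCompact_Icc (a := t - ε) (b := t + ε))
    fun _ hx => rescaled_eq_zero h hε hx

lemma integrable_rescaled_mul {ψ f : ℝ → ℝ} (hψ : Continuous ψ)
    (h : Function.support ψ ⊆ Set.Icc (-1) 1) (hf : LocallyIntegrable f) {ε : ℝ} (hε : 0 < ε)
    (t : ℝ) : Integrable fun x => ψ ((t - x) / ε) * f x :=
  hf.integrable_smul_left_of_hasCompactSupport (g := fun x => ψ ((t - x) / ε)) (by fun_prop)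
    (hasCompactSupport_rescaled h hε t)

lemma mollify_add {ψ f g : ℝ → ℝ} (hψ : Continuous ψ) (h : Function.support ψ ⊆ Set.Icc (-1) 1)
    (hf : LocallyIntegrable f) (hg : LocallyIntegrable g) {ε : ℝ} (hε : 0 < ε) (t : ℝ) :
    mollify ψ ε (fun x => f x + g x) t = mollify ψ ε f t + mollify ψ ε g t := by
  simp only [mollify, mul_add]
  rw [integral_add (integrable_rescaled_mul hψ h hf hε t) (integrable_rescaled_mul hψ h hg hε t),
    mul_add]

lemma mollify_const_mul (ψ f : ℝ → ℝ) (c ε t : ℝ) :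
    mollify ψ ε (fun x => c * f x) t = c * mollify ψ ε f t := by
  simp only [mollify, mul_left_comm _ c, integral_const_mul]

lemma hasDerivAt_mollify {ψ f : ℝ → ℝ} (hψ : ContDiff ℝ 1 ψ)
    (h : Function.support ψ ⊆ Set.Icc (-1) 1) (hf : LocallyIntegrable f) {ε : ℝ} (hε : 0 < ε)
    (t : ℝ) : HasDerivAt (mollify ψ ε f) (ε⁻¹ * mollify (deriv ψ) ε f t) t := by
  have hsupp : HasCompactSupport fun x => ψ (x / ε) :=
    HasCompactSupport.intro (isCompact_Icc (a := -ε) (b := ε)) fun x hx => by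
      simpa using rescaled_eq_zero h hε (t := 0) (x := -x)
        (fun hx' => hx ⟨by linarith [hx'.2], by linarith [hx'.1]⟩)
  have hderiv : deriv (fun x => ψ (x / ε)) = fun x => ε⁻¹ * deriv ψ (x / ε) := by
    ext x
    have := ((hψ.differentiable one_ne_zero (x / ε)).hasDerivAt).comp x
      ((hasDerivAt_id x).div_const ε)
    simpa [Function.comp_def, div_eq_mul_inv, mul_comm] using this.deriv
  have key := (hsupp.hasDerivAt_convolution_left (ContinuousLinearMap.mul ℝ ℝ) (μ := volume)
    (hψ.comp (contDiff_id.div_const ε)) hf t).const_mul ε⁻¹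
  rw [hderiv] at key
  convert! key using 1
  · ext s
    simp only [mollify, convolution_mul_swap]
  · simp only [mollify, convolution_mul_swap, mul_assoc, integral_const_mul]

lemma IsKernel.contDiff_deriv {φ : ℝ → ℝ} (hφ : IsKernel φ) : ContDiff ℝ 1 (deriv φ) := by
  have h : ContDiff ℝ (1 + 1) φ := by
    rw [one_add_one_eq_two]
    exact hφ.smooth
  exact (contDiff_succ_iff_deriv.1 h).2.2

lemma dd_mollify {φ f : ℝ → ℝ} (hφ : IsKernel φ) (hf : LocallyIntegrable f) {ε : ℝ} (hε : 0 < ε)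
    (t : ℝ) : dd (mollify φ ε f) t = ε⁻¹ ^ 2 * mollify (deriv (deriv φ)) ε f t := by
  have hφ' := hφ.contDiff_deriv
  have h₁ : deriv (mollify φ ε f) = fun s => ε⁻¹ * mollify (deriv φ) ε f s :=
    funext fun s => (hasDerivAt_mollify (hφ.smooth.of_le one_le_two) hφ.support hf hε s).deriv
  rw [dd, h₁, ((hasDerivAt_mollify hφ' (support_deriv_subset_Icc hφ.support) hf hε t).const_mul
    ε⁻¹).deriv]
  ring

lemma continuous_deriv_deriv {φ : ℝ → ℝ} (hφ : IsKernel φ) : Continuous (deriv (deriv φ)) :=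
  (contDiff_one_iff_deriv.1 hφ.contDiff_deriv).2

lemma support_deriv_deriv_subset {φ : ℝ → ℝ} (hφ : IsKernel φ) :
    Function.support (deriv (deriv φ)) ⊆ Set.Icc (-1) 1 :=
  support_deriv_subset_Icc (support_deriv_subset_Icc hφ.support)

lemma mollify_deriv_deriv_affine {φ : ℝ → ℝ} (hφ : IsKernel φ) (α β : ℝ) {ε : ℝ} (hε : 0 < ε)
    (t : ℝ) : mollify (deriv (deriv φ)) ε (fun x => α * x + β) t = 0 := by
  have hφ' := hφ.contDiff_deriv
  have haff : LocallyIntegrable fun x : ℝ => α * x + β :=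
    Continuous.locallyIntegrable (by fun_prop)
  have hsub (x : ℝ) : HasDerivAt (fun y : ℝ => (t - y) / ε) (-1 / ε) x :=
    ((hasDerivAt_id x).const_sub t).div_const ε
  have hd (x : ℝ) : HasDerivAt
      (fun y => -ε * (deriv φ ((t - y) / ε) * (α * y + β)) - ε ^ 2 * (φ ((t - y) / ε) * α))
      (deriv (deriv φ) ((t - x) / ε) * (α * x + β)) x := by
    have h₁ := ((hφ'.differentiable one_ne_zero ((t - x) / ε)).hasDerivAt).comp x (hsub x)
    have h₀ := ((hφ.smooth.differentiable two_ne_zero ((t - x) / ε)).hasDerivAt).comp x (hsub x)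
    have hl : HasDerivAt (fun y : ℝ => α * y + β) α x := by
      simpa using ((hasDerivAt_id x).const_mul α).add_const β
    convert! ((h₁.mul hl).const_mul (-ε)).sub ((h₀.mul_const α).const_mul (ε ^ 2)) using 1
    simp only [Function.comp_apply]
    field_simp
    ring
  rw [mollify, integral_eq_zero_of_hasDerivAt_of_integrable hd, mul_zero]
  · exact integrable_rescaled_mul (continuous_deriv_deriv hφ) (support_deriv_deriv_subset hφ)
      haff hε t
  · exact ((integrable_rescaled_mul hφ'.continuous (support_deriv_subset_Icc hφ.support)
      haff hε t).const_mul _).sub ((integrable_rescaled_mul hφ.smooth.continuous hφ.support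
      (locallyIntegrable_const α) hε t).const_mul _)

lemma abs_mollify_le {ψ f : ℝ → ℝ} (h : Function.support ψ ⊆ Set.Icc (-1) 1) {ε M B t : ℝ}
    (hε : 0 < ε) (hM : ∀ x, |ψ x| ≤ M) (hB : ∀ x ∈ Set.Icc (t - ε) (t + ε), |f x| ≤ B) :
    |mollify ψ ε f t| ≤ 2 * M * B := by
  have hM0 : 0 ≤ M := (abs_nonneg _).trans (hM 0)
  have hint : ∫ x in Set.Icc (t - ε) (t + ε), ψ ((t - x) / ε) * f x
      = ∫ x, ψ ((t - x) / ε) * f x :=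
    setIntegral_eq_integral_of_forall_compl_eq_zero fun x hx => by
      rw [rescaled_eq_zero h hε hx, zero_mul]
  have hle := norm_setIntegral_le_of_norm_le_const (μ := volume) (s := Set.Icc (t - ε) (t + ε))
    (f := fun x => ψ ((t - x) / ε) * f x) (C := M * B) (by simp) fun x hx => by
      rw [Real.norm_eq_abs, abs_mul]
      exact mul_le_mul (hM _) (hB x hx) (abs_nonneg _) hM0
  rw [hint, Real.norm_eq_abs, Real.volume_real_Icc_of_le (by linarith)] at hle
  rw [mollify, abs_mul, abs_of_pos (inv_pos.2 hε)]
  calc ε⁻¹ * |∫ x, ψ ((t - x) / ε) * f x|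
      ≤ ε⁻¹ * (M * B * (t + ε - (t - ε))) := by gcongr
    _ = 2 * M * B := by field_simp; ring

lemma IsFBM.ae_zero {P : Measure Ω} [IsProbabilityMeasure P] {H : ℝ} {bH : ℝ → Ω → ℝ}
    (h : IsFBM P H bH) (hH : 0 < H) : ∀ᵐ ω ∂P, bH 0 ω = 0 := by
  obtain ⟨v, hv⟩ := h.gaussian 1 (fun _ => 0) (fun _ => 1)
  simp only [Fin.sum_univ_one, one_mul] at hv
  have hmem : MemLp id 2 (P.map (bH 0)) := hv ▸ memLp_id_gaussianReal' 2 (by simp)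
  have hmem' : MemLp (bH 0) 2 P := hmem.comp_of_map (h.measurable 0).aemeasurable
  have hcov := h.covariance 0 0
  have hcov0 : fbmCov H 0 0 = 0 := by
    simp [fbmCov, Real.zero_rpow (by positivity : 2 * H ≠ 0)]
  simp only [hcov0, ← sq] at hcov
  rw [integral_eq_zero_iff_of_nonneg (fun ω => sq_nonneg _) hmem'.integrable_sq] at hcov
  filter_upwards [hcov] with ω hω
  simpa using hω

/-- If `X` is the solution started from `0` with path `b`, then the second derivative of its
smoothing differs from that of `s • b` only through the values of `b` on the negative half line. -/
lemma dd_mollify_solution_sub {φ b X : ℝ → ℝ} (hφ : IsKernel φ) (hb : Continuous b) {s m c : ℝ}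
    (hX : ∀ x, X x = if 0 ≤ x then s * b x + m * x + c else c) {ε : ℝ} (hε : 0 < ε) (t : ℝ) :
    dd (mollify φ ε X) t - s * dd (mollify φ ε b) t
      = ε⁻¹ ^ 2 * mollify (deriv (deriv φ)) ε
          ((Set.Iio 0).indicator fun x => -(s * b x + m * x)) t := by
  set r : ℝ → ℝ := (Set.Iio 0).indicator fun x => -(s * b x + m * x) with hr
  have hdec : X = fun x => (s * b x + (m * x + c)) + r x := by
    ext x
    by_cases hx : 0 ≤ x
    · simp [hX, hr, hx, add_assoc]
    · simp only [hX, hr, hx, if_false, Set.indicator_of_mem (Set.mem_Iio.2 (not_le.1 hx))]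
      ring
  have hsb : LocallyIntegrable fun x => s * b x := Continuous.locallyIntegrable (by fun_prop)
  have haff : LocallyIntegrable fun x : ℝ => m * x + c :=
    Continuous.locallyIntegrable (by fun_prop)
  have hsum : LocallyIntegrable fun x => s * b x + (m * x + c) := hsb.add haff
  have hr_int : LocallyIntegrable r :=
    LocallyIntegrable.indicator (Continuous.locallyIntegrable (by fun_prop)) measurableSet_Iio
  have hψ := continuous_deriv_deriv hφ
  have hsupp := support_deriv_deriv_subset hφ
  have hall : LocallyIntegrable fun x => s * b x + (m * x + c) + r x := hsum.add hr_int
  rw [hdec, dd_mollify hφ hall hε, dd_mollify hφ hb.locallyIntegrable hε,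
    mollify_add hψ hsupp hsum hr_int hε, mollify_add hψ hsupp hsb haff hε,
    mollify_const_mul, mollify_deriv_deriv_affine hφ m c hε]
  ring

/-- Lemma 3.3, first model: under the contiguous alternatives
`σ_ε = σ + √ε(d + F(√ε))`, on `[0,1]` one has `Ÿ_ε(t) = σ_ε b̈_H^ε(t) + a_ε(t)` with
`|a_ε(t)| ≤ C(ω)(ε^{H-2-δ} 1_{[0,ε]}(t) + ε^{2H-2-δ} 1_{[ε,1]}(t))`. -/
theorem statement18 (P : Measure Ω) [IsProbabilityMeasure P]
    (H : ℝ) (hH0 : 1/2 < H) (hH1 : H < 1)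
    (bH : ℝ → Ω → ℝ) (hbH : IsFBM P H bH)
    (φ : ℝ → ℝ) (hφ : IsKernel φ)
    (σ d μ x₀ : ℝ) (hσ : 0 < σ) (hd : 0 < d)
    (F : ℝ → ℝ) (hF : ∀ x, 0 ≤ F x)
    (hFlim : Tendsto (fun ε : ℝ => F (Real.sqrt ε)) (𝓝[>] (0 : ℝ)) (𝓝 0))
    (Xsol : ℝ → ℝ → Ω → ℝ)
    (hXsol : ∀ ε t ω, Xsol ε t ω =
      if 0 ≤ t then (σ + Real.sqrt ε * (d + F (Real.sqrt ε))) * bH t ω + μ * t + x₀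
      else x₀)
    (a : ℝ → Ω → ℝ → ℝ)
    (ha : ∀ ε ω t, a ε ω t
        = dd (mollify φ ε fun s => Xsol ε s ω) t
          - (σ + Real.sqrt ε * (d + F (Real.sqrt ε))) * dd (mollify φ ε fun s => bH s ω) t)
    (δ : ℝ) (hδ : 0 < δ) :
    ∀ᵐ ω ∂P, ∃ C > 0, ∃ ε₀ > 0, ∀ ε : ℝ, 0 < ε → ε ≤ ε₀ → ∀ t ∈ Set.Icc (0:ℝ) 1,
      dd (mollify φ ε fun s => Xsol ε s ω) t
        = (σ + Real.sqrt ε * (d + F (Real.sqrt ε))) * dd (mollify φ ε fun s => bH s ω) t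
          + a ε ω t ∧
      |a ε ω t| ≤ C * (Set.indicator (Set.Icc 0 ε) (fun _ => ε ^ (H - 2 - δ)) t
          + Set.indicator (Set.Icc ε 1) (fun _ => ε ^ (2 * H - 2 - δ)) t) := by
  have hη : 0 < min δ (1 / 4) := by positivity
  have hηH : min δ (1 / 4) < H := (min_le_right _ _).trans_lt (by linarith)
  obtain ⟨M, hM⟩ := (continuous_deriv_deriv hφ).bounded_above_of_compact_support
    (HasCompactSupport.intro isCompact_Icc fun x hx =>
      by_contra fun hne => hx (support_deriv_deriv_subset hφ hne))
  simp only [Real.norm_eq_abs] at hM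
  have hM0 : 0 ≤ M := (abs_nonneg _).trans (hM 0)
  obtain ⟨ε₁, hε₁, hFε⟩ : ∃ ε₁ > 0, ∀ ε, 0 < ε → ε < ε₁ → F (Real.sqrt ε) < 1 := by
    obtain ⟨u, hu, hsub⟩ := mem_nhdsGT_iff_exists_Ioo_subset.1
      (hFlim.eventually (gt_mem_nhds one_pos))
    exact ⟨u, hu, fun ε h₀ h₁ => hsub ⟨h₀, h₁⟩⟩
  filter_upwards [hbH.cont, hbH.holder _ hη hηH, hbH.ae_zero (by linarith)] with ω hcont hhol hzero
  obtain ⟨C, hC, hCb⟩ := hhol 1 one_pos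
  set K : ℝ := (σ + (d + 1)) * C + |μ| with hK
  have hK0 : 0 ≤ K := by positivity
  refine ⟨2 * M * K + 1, by positivity, min 1 (ε₁ / 2), by positivity, ?_⟩
  intro ε hε hεle t ht
  refine ⟨by rw [ha]; ring, ?_⟩
  have hε1 : ε ≤ 1 := hεle.trans (min_le_left _ _)
  have hF1 : F (Real.sqrt ε) ≤ 1 :=
    (hFε ε hε (by linarith [hεle.trans (min_le_right 1 (ε₁ / 2))])).le
  set s : ℝ := σ + Real.sqrt ε * (d + F (Real.sqrt ε))
  have hFn := hF (Real.sqrt ε)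
  have hs0 : 0 ≤ s := by positivity
  have hs1 : s ≤ σ + (d + 1) := by
    have h₁ : Real.sqrt ε ≤ 1 := Real.sqrt_le_one.2 hε1
    have : Real.sqrt ε * (d + F (Real.sqrt ε)) ≤ 1 * (d + 1) := by gcongr
    linarith
  rw [ha, dd_mollify_solution_sub hφ hcont (fun x => hXsol ε x ω) hε t]
  have hind₁ : 0 ≤ Set.indicator (Set.Icc ε 1) (fun _ => ε ^ (2 * H - 2 - δ)) t :=
    Set.indicator_nonneg (fun _ _ => by positivity) t
  have hind₀ : 0 ≤ Set.indicator (Set.Icc 0 ε) (fun _ => ε ^ (H - 2 - δ)) t :=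
    Set.indicator_nonneg (fun _ _ => by positivity) t
  rw [abs_mul, abs_of_nonneg (by positivity : 0 ≤ ε⁻¹ ^ 2)]
  rcases le_total ε t with htε | htε
  · have hz := abs_mollify_le (support_deriv_deriv_subset hφ) (t := t) (B := 0)
      (f := (Set.Iio 0).indicator fun x => -(s * bH x ω + μ * x)) hε hM fun x hx => by
        rw [Set.indicator_of_notMem (by simpa using (by linarith [hx.1] : 0 ≤ x)), abs_zero]
    rw [mul_zero] at hz
    rw [le_antisymm hz (abs_nonneg _), mul_zero]
    positivity
  · have hB := abs_mollify_le (support_deriv_deriv_subset hφ) (t := t) (B := K * ε ^ (H - δ))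
      (f := (Set.Iio 0).indicator fun x => -(s * bH x ω + μ * x)) hε hM fun x hx => by
        by_cases hx0 : x ∈ Set.Iio 0
        · rw [Set.indicator_of_mem hx0, abs_neg]
          have hx0' : x < 0 := hx0
          have hxε : |x| ≤ ε := by rw [abs_of_neg hx0']; linarith [hx.1, ht.1]
          have hbx := hCb 0 (by simp) x ⟨by linarith [hx.1, ht.1], by linarith⟩
          rw [hzero, sub_zero, sub_zero] at hbx
          have hpow : |x| ^ (H - min δ (1 / 4)) ≤ ε ^ (H - δ) :=
            (Real.rpow_le_rpow (abs_nonneg x) hxε (by linarith)).trans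
              (Real.rpow_le_rpow_of_exponent_ge hε hε1 (by linarith [min_le_left δ (1 / 4)]))
          have hlin : |x| ≤ ε ^ (H - δ) := hxε.trans
            (by simpa using Real.rpow_le_rpow_of_exponent_ge hε hε1 (by linarith : H - δ ≤ 1))
          calc |s * bH x ω + μ * x| ≤ |s * bH x ω| + |μ * x| := abs_add_le _ _
            _ = s * |bH x ω| + |μ| * |x| := by rw [abs_mul, abs_mul, abs_of_nonneg hs0]
            _ ≤ (σ + (d + 1)) * (C * ε ^ (H - δ)) + |μ| * ε ^ (H - δ) := by
              gcongr
              exact hbx.trans (by gcongr)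
            _ = K * ε ^ (H - δ) := by rw [hK]; ring
        · rw [Set.indicator_of_notMem hx0, abs_zero]
          positivity
    have hexp : ε⁻¹ ^ 2 * ε ^ (H - δ) = ε ^ (H - 2 - δ) := by
      rw [show H - 2 - δ = (H - δ) - (2 : ℕ) by push_cast; ring, Real.rpow_sub_natCast hε.ne',
        inv_pow, div_eq_inv_mul]
    rw [Set.indicator_of_mem (show t ∈ Set.Icc 0 ε from ⟨ht.1, htε⟩)] at hind₀ ⊢
    calc _ ≤ ε⁻¹ ^ 2 * (2 * M * (K * ε ^ (H - δ))) := by gcongr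
      _ = 2 * M * K * ε ^ (H - 2 - δ) := by rw [← hexp]; ring
      _ ≤ _ := by gcongr <;> linarith

end FBMPaper
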